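/- Proposition 5.2(5): Let K be the attractor of a system of injective contractions S_i (i ∈ I) on a complete metric space, suppose K is a dendrite and the self-similar boundary ∂K is finite, and let T be the main tree of K. Then T ⊆ ⋃_{i∈I} S_i(T). -/

import Mathlib

/-- `SWord S w` is the composition `S_{i₁} ∘ ⋯ ∘ S_{iₙ}` for the word `w = i₁…iₙ`
(the identity for the empty word). -/
def SWord {X : Type*} {m : ℕ} (S : Fin m → X → X) : List (Fin m) → X → X
  | [] => id
  | i :: w => S i ∘ SWord S w

/-- `α : ℕ → Fin m` is an address of `x` if `x ∈ K_{α|n} = S_{α(0)…α(n-1)}(K)`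
for every `n ≥ 1`. -/
def IsAddress {X : Type*} {m : ℕ} (S : Fin m → X → X) (K : Set X) (x : X)
    (α : ℕ → Fin m) : Prop :=
  ∀ n : ℕ, 1 ≤ n → x ∈ SWord S (List.ofFn fun k : Fin n => α k.val) '' K

/-- The critical set `C = ⋃_{i ≠ j} (K_i ∩ K_j)`. -/
def CriticalSet {X : Type*} {m : ℕ} (S : Fin m → X → X) (K : Set X) : Set X :=
  ⋃ (i : Fin m) (j : Fin m) (_ : i ≠ j), (S i '' K) ∩ (S j '' K)

/-- The self-similar boundary
`∂K = {x ∈ K : S_w(x) ∈ C for some nonempty word w}`. -/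
def SSBoundary {X : Type*} {m : ℕ} (S : Fin m → X → X) (K : Set X) : Set X :=
  {x | x ∈ K ∧ ∃ w : List (Fin m), w ≠ [] ∧ SWord S w x ∈ CriticalSet S K}

/-- `K` is a dendrite: compact, connected, locally connected (as a subspace), and
admitting no continuous injection of the unit circle. -/
def IsDendrite {X : Type*} [TopologicalSpace X] (K : Set X) : Prop :=
  IsCompact K ∧ IsConnected K ∧ LocallyConnectedSpace K ∧
    ∀ f : (Metric.sphere (0 : ℂ) 1) → K, Continuous f → ¬ Function.Injective f

/-- The set of connected components of the set `A`. -/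
def ComponentsIn {X : Type*} [TopologicalSpace X] (A : Set X) : Set (Set X) :=
  {C | ∃ y ∈ A, C = connectedComponentIn A y}

/-- The main tree of `K`: the intersection of all closed connected sets `A` with
`∂K ⊆ A ⊆ K`. -/
def MainTree {X : Type*} [TopologicalSpace X] {m : ℕ} (S : Fin m → X → X)
    (K : Set X) : Set X :=
  ⋂₀ {A : Set X | IsClosed A ∧ IsConnected A ∧ SSBoundary S K ⊆ A ∧ A ⊆ K}

open Set

theorem SWord_append {X : Type*} {m : ℕ} (S : Fin m → X → X) (v w : List (Fin m)) :
    SWord S (v ++ w) = SWord S v ∘ SWord S w := by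
  induction v with
  | nil => rfl
  | cons i v ih => simp [SWord, ih, Function.comp_assoc]

/-- A point of `K` mapped into the boundary by some `S i` lies in the boundary. -/
theorem mem_SSBoundary_of_image_mem {X : Type*} {m : ℕ} {S : Fin m → X → X} {K : Set X}
    {i : Fin m} {x : X} (hx : x ∈ K) (h : S i x ∈ SSBoundary S K) : x ∈ SSBoundary S K := by
  obtain ⟨-, w, -, hw⟩ := h
  exact ⟨hx, w ++ [i], by simp, by simpa [SWord_append, SWord] using hw⟩

theorem mem_SSBoundary_of_image_mem_inter {X : Type*} {m : ℕ} {S : Fin m → X → X} {K : Set X}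
    {i j : Fin m} (hij : i ≠ j) {x : X} (hx : x ∈ K) (h : S i x ∈ S j '' K) :
    x ∈ SSBoundary S K :=
  ⟨hx, [i], by simp, mem_iUnion.2 ⟨i, mem_iUnion.2 ⟨j, mem_iUnion.2
    ⟨hij, mem_image_of_mem _ hx, h⟩⟩⟩⟩

theorem SSBoundary_subset_iUnion_image {X : Type*} {m : ℕ} {S : Fin m → X → X} {K : Set X}
    (hK : K = ⋃ i, S i '' K) : SSBoundary S K ⊆ ⋃ i, S i '' SSBoundary S K := by
  intro x hx
  have hxK := hx.1
  rw [hK] at hxK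
  obtain ⟨i, y, hy, rfl⟩ := mem_iUnion.1 hxK
  exact mem_iUnion.2 ⟨i, y, mem_SSBoundary_of_image_mem hy hx, rfl⟩

/-- If a finite union of nonempty closed sets is preconnected, then any two of the sets are
joined by a chain of successively intersecting ones. -/
theorem IsPreconnected.reflTransGen_of_iUnion_isClosed {X ι : Type*} [TopologicalSpace X]
    [Finite ι] {s : ι → Set X} (hs : IsPreconnected (⋃ i, s i)) (hc : ∀ i, IsClosed (s i))
    (hne : ∀ i, (s i).Nonempty) (i j : ι) :
    Relation.ReflTransGen (fun i j => (s i ∩ s j).Nonempty) i j := by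
  by_contra hij
  set J : Set ι := {k | Relation.ReflTransGen (fun i j => (s i ∩ s j).Nonempty) i k}
  obtain ⟨x, -, hxJ, hxJ'⟩ := isPreconnected_closed_iff.1 hs (⋃ k ∈ J, s k) (⋃ k ∈ Jᶜ, s k)
    (J.toFinite.isClosed_biUnion fun k _ => hc k)
    (Jᶜ.toFinite.isClosed_biUnion fun k _ => hc k)
    (iUnion_subset fun k => by
      by_cases hk : k ∈ J
      · exact (subset_biUnion_of_mem (u := s) hk).trans subset_union_left
      · exact (subset_biUnion_of_mem (u := s) (show k ∈ Jᶜ from hk)).trans subset_union_right)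
    (by
      obtain ⟨y, hy⟩ := hne i
      exact ⟨y, mem_iUnion.2 ⟨i, hy⟩, mem_biUnion (show i ∈ J from .refl) hy⟩)
    (by
      obtain ⟨y, hy⟩ := hne j
      exact ⟨y, mem_iUnion.2 ⟨j, hy⟩, mem_biUnion (show j ∈ Jᶜ from hij) hy⟩)
  obtain ⟨k, hk, hxk⟩ := mem_iUnion₂.1 hxJ
  obtain ⟨l, hl, hxl⟩ := mem_iUnion₂.1 hxJ'
  exact hl (Relation.ReflTransGen.tail hk ⟨x, hxk, hxl⟩)

/-- Images of connected sets containing the boundary, one for each map of the system, have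
connected union when the attractor is connected. -/
theorem isConnected_iUnion_images {X : Type*} [TopologicalSpace X] [T2Space X] {m : ℕ}
    {S : Fin m → X → X} {K : Set X} (hS : ∀ i, Continuous (S i)) (hKcp : IsCompact K)
    (hKconn : IsConnected K) (hK : K = ⋃ i, S i '' K) {A : Fin m → Set X}
    (hA : ∀ i, IsConnected (A i)) (hbd : ∀ i, SSBoundary S K ⊆ A i) :
    IsConnected (⋃ i, S i '' A i) := by
  have hne : Nonempty (Fin m) := by
    obtain ⟨x, hx⟩ := hKconn.nonempty
    rw [hK] at hx
    exact ⟨(mem_iUnion.1 hx).choose⟩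
  refine IsConnected.iUnion_of_reflTransGen (fun i => (hA i).image _ (hS i).continuousOn)
    fun i j => ?_
  refine Relation.ReflTransGen.mono ?_ _ _ (IsPreconnected.reflTransGen_of_iUnion_isClosed
    (s := fun i => S i '' K) (hK ▸ hKconn.isPreconnected)
    (fun i => (hKcp.image (hS i)).isClosed) (fun i => hKconn.nonempty.image _) i j)
  rintro k l ⟨_, ⟨y, hy, rfl⟩, ⟨z, hz, hzy⟩⟩
  by_cases hkl : k = l
  · subst hkl
    simpa using (hA k).nonempty
  · exact ⟨S k y, mem_image_of_mem _ (hbd k (mem_SSBoundary_of_image_mem_inter hkl hy ⟨z, hz, hzy⟩)),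
      z, hbd l (mem_SSBoundary_of_image_mem_inter (Ne.symm hkl) hz ⟨y, hy, hzy.symm⟩), hzy⟩

/-- **Proposition 5.2(5)**: the main tree satisfies `T ⊆ ⋃ᵢ Sᵢ(T)`. -/
theorem main_tree_subset_union_images
    {X : Type*} [MetricSpace X] [CompleteSpace X] {m : ℕ}
    (S : Fin m → X → X) (r : Fin m → NNReal) (hr : ∀ i, r i < 1)
    (hlip : ∀ i, LipschitzWith (r i) (S i)) (hinj : ∀ i, Function.Injective (S i))
    (K : Set X) (hKne : K.Nonempty) (hKcp : IsCompact K) (hKeq : K = ⋃ i, S i '' K)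
    (hdend : IsDendrite K) (hfin : (SSBoundary S K).Finite) :
    MainTree S K ⊆ ⋃ i : Fin m, S i '' MainTree S K := by
  intro x hx
  by_contra hxn
  have key : ∀ i, ∃ A : Set X, (IsClosed A ∧ IsConnected A ∧ SSBoundary S K ⊆ A ∧ A ⊆ K) ∧
      x ∉ S i '' A := by
    intro i
    by_contra! h
    apply hxn
    obtain ⟨y, -, hy⟩ :=
      h K ⟨hKcp.isClosed, hdend.2.1, fun _ hz => hz.1, subset_rfl⟩
    refine mem_iUnion.2 ⟨i, y, fun A hA => ?_, hy⟩
    obtain ⟨z, hz, hzx⟩ := h A hA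
    rwa [hinj i (hy.trans hzx.symm)]
  choose A hA hxA using key
  have hmem := hx (⋃ i, S i '' A i)
    ⟨isClosed_iUnion_of_finite fun i =>
        ((hKcp.of_isClosed_subset (hA i).1 (hA i).2.2.2).image (hlip i).continuous).isClosed,
      isConnected_iUnion_images (fun i => (hlip i).continuous) hKcp hdend.2.1 hKeq
        (fun i => (hA i).2.1) fun i => (hA i).2.2.1,
      (SSBoundary_subset_iUnion_image hKeq).trans
        (iUnion_mono fun i => image_mono (hA i).2.2.1),
      (iUnion_mono fun i => image_mono (hA i).2.2.2).trans hKeq.ge⟩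
  obtain ⟨i, hi⟩ := mem_iUnion.1 hmem
  exact hxA i hi
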